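/- arXiv:2102.03695 — 2 statements merged into one kernel-verified Lean document; each statement's English description precedes it below -/
import Mathlib

section
/- Let q^{1/2} and θ₁,…,θ₅ be indeterminates. Write ξ = (θ₁θ₂θ₃θ₄θ₅)^{1/2} (adjoin a square root). Then, as an identity of rational functions: Σ over the Weyl group W of type C₅ (signed permutations of θ₁,…,θ₅, acting by permuting indices and inverting variables), modulo the subgroup S₄×S₂ (S₄ permuting θ₁,…,θ₄ and S₂ = {1, θ₅ ↦ θ₅^{-1}}), of w( [ (1 − q^{-1/2}ξ) · ∏_{i=1}^{5}(1 − q^{-1/2}ξ/θ_i) · ∏_{i=1}^{4}(1 − q^{-1/2}ξ/(θ_iθ₅)) ] / [ ∏_{1≤i<j≤5}(1 − θ_iθ_j) · ∏_{i=1}^{4}(1 − θ_i) · ∏_{i=1}^{4}(1 − θ_i/θ₅) ] ) = 1. (The summand is invariant under S₄×S₂, so the coset sum is well defined.) -/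
/-- `x ^ ε` for a sign `ε ∈ {±1}` encoded by a `Bool` (`false ↔ +1`, `true ↔ −1`). -/
def signPow' {K : Type*} [Field K] (x : K) (b : Bool) : K := if b then x⁻¹ else x

/-- The signed permutation `w` applied to the variables `η`. -/
def signAct {K : Type*} [Field K] (η : Fin 5 → K) (w : Equiv.Perm (Fin 5) × (Fin 5 → Bool)) :
    Fin 5 → K := fun i => signPow' (η (w.1 i)) (w.2 i)

/-- The determinant of a signed permutation. -/
def weylSign (w : Equiv.Perm (Fin 5) × (Fin 5 → Bool)) : ℤ :=
  Equiv.Perm.sign w.1 * ∏ i, if w.2 i then -1 else 1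

/-- The antisymmetrization of `f` over the Weyl group of type `C₅`, evaluated at `η`. -/
def alternate {K : Type*} [Field K] (η : Fin 5 → K) (f : (Fin 5 → K) → K) : K :=
  ∑ w, (weylSign w : K) * f (signAct η w)

/-- The Laurent monomial with exponent vector `e`. -/
def laurent {K : Type*} [Field K] (e : Fin 5 → ℤ) (x : Fin 5 → K) : K := ∏ i, x i ^ e i

/-- The alternant attached to the exponent vector `e`. -/
def alternant {K : Type*} [Field K] (e : Fin 5 → ℤ) (x : Fin 5 → K) : K :=
  (Matrix.of fun i j => x i ^ e j - (x i)⁻¹ ^ e j).det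

/-- Inversion of the last variable. -/
def invLast {K : Type*} [Field K] (x : Fin 5 → K) : Fin 5 → K := Function.update x 4 (x 4)⁻¹

/-- A permutation of the first four variables, as a permutation of all five. -/
def extendPerm (τ : Equiv.Perm (Fin 4)) : Equiv.Perm (Fin 5) :=
  τ.viaFintypeEmbedding Fin.castSuccEmb

/-- The numerator weights (in the variables `η`). -/
def spinWeight : Fin 10 → Fin 5 → ℤ :=
  ![![1, 1, 1, 1, 1], ![-1, 1, 1, 1, 1], ![1, -1, 1, 1, 1], ![1, 1, -1, 1, 1], ![1, 1, 1, -1, 1],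
    ![1, 1, 1, 1, -1], ![-1, 1, 1, 1, -1], ![1, -1, 1, 1, -1], ![1, 1, -1, 1, -1],
    ![1, 1, 1, -1, -1]]

/-- A representative of the Weyl orbit of `2ρ` for the root system `B₅`. -/
def rhoExponent : Fin 5 → ℤ := ![-3, -5, -7, -9, 1]

/-- The numerator of the summand. -/
def numer {K : Type*} [Field K] (t : K) (x : Fin 5 → K) : K :=
  (1 - t * ∏ i, x i) * (∏ i, (1 - t * (∏ i, x i) / x i ^ 2)) *
    ∏ i : Fin 4, (1 - t * (∏ i, x i) / (x i.castSucc ^ 2 * x 4 ^ 2))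

/-- The denominator of the summand. -/
def denom {K : Type*} [Field K] (x : Fin 5 → K) : K :=
  (∏ p ∈ Finset.univ.filter (fun p : Fin 5 × Fin 5 => p.1 < p.2), (1 - x p.1 ^ 2 * x p.2 ^ 2)) *
    (∏ i : Fin 4, (1 - x i.castSucc ^ 2)) * ∏ i : Fin 4, (1 - x i.castSucc ^ 2 / x 4 ^ 2)

/-- The antisymmetrization of `laurent rhoExponent` over `S₄ × S₂`. -/
def partialAlternant {K : Type*} [Field K] (x : Fin 5 → K) : K :=
  ∑ τ : Equiv.Perm (Fin 4), ((Equiv.Perm.sign τ : ℤ) : K) *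
    (laurent rhoExponent (x ∘ extendPerm τ) - laurent rhoExponent (invLast x ∘ extendPerm τ))

section

variable {K : Type*} [Field K]

lemma signPow'_ne_zero {x : K} (hx : x ≠ 0) (b : Bool) : signPow' x b ≠ 0 := by
  cases b <;> simp [signPow', hx]

lemma extendPerm_castSucc (τ : Equiv.Perm (Fin 4)) (i : Fin 4) :
    extendPerm τ i.castSucc = (τ i).castSucc :=
  Equiv.Perm.viaFintypeEmbedding_apply_image τ Fin.castSuccEmb i

lemma extendPerm_last (τ : Equiv.Perm (Fin 4)) : extendPerm τ 4 = 4 := by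
  apply Equiv.Perm.viaFintypeEmbedding_apply_notMem_range
  rintro ⟨i, hi⟩
  exact (Fin.castSucc_lt_last i).ne hi

lemma sign_extendPerm (τ : Equiv.Perm (Fin 4)) :
    Equiv.Perm.sign (extendPerm τ) = Equiv.Perm.sign τ :=
  Equiv.Perm.viaFintypeEmbedding_sign _ _

lemma weylSign_mul_self (w) : weylSign w * weylSign w = 1 := by
  have h : ∀ b : Bool, (if b then (-1 : ℤ) else 1) * (if b then (-1 : ℤ) else 1) = 1 := by decide
  have hs : ((Equiv.Perm.sign w.1 : ℤˣ) : ℤ) * (Equiv.Perm.sign w.1 : ℤˣ) = 1 := by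
    rw [← Units.val_mul, Int.units_mul_self, Units.val_one]
  rw [weylSign, mul_mul_mul_comm, hs, ← Finset.prod_mul_distrib, Finset.prod_congr rfl
    (fun i _ => h (w.2 i))]
  simp

lemma alternate_comp_perm (η : Fin 5 → K) (f : (Fin 5 → K) → K) (τ : Equiv.Perm (Fin 5)) :
    alternate η (fun x => f (x ∘ τ)) = ((Equiv.Perm.sign τ : ℤ) : K) * alternate η f := by
  rw [alternate, alternate, Finset.mul_sum]
  refine Fintype.sum_equiv
    ((Equiv.mulRight τ).prodCongr (Equiv.arrowCongr τ.symm (Equiv.refl Bool))) _ _ fun w => ?_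
  have h1 : signAct η (((Equiv.mulRight τ).prodCongr
      (Equiv.arrowCongr τ.symm (Equiv.refl Bool))) w) = signAct η w ∘ τ := by
    ext i; simp [signAct]
  have hs : ((Equiv.Perm.sign τ : ℤˣ) : ℤ) * (Equiv.Perm.sign τ : ℤˣ) = 1 := by
    rw [← Units.val_mul, Int.units_mul_self, Units.val_one]
  have h2 : ((Equiv.Perm.sign τ : ℤˣ) : ℤ) * weylSign (((Equiv.mulRight τ).prodCongr
      (Equiv.arrowCongr τ.symm (Equiv.refl Bool))) w) = weylSign w := by
    have h3 : ∏ i, (if w.2 (τ i) then (-1 : ℤ) else 1) = ∏ i, if w.2 i then (-1 : ℤ) else 1 :=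
      Equiv.prod_comp τ fun i => if w.2 i then (-1 : ℤ) else 1
    simp only [weylSign, Equiv.prodCongr_apply, Prod.map_fst, Prod.map_snd, Equiv.coe_mulRight,
      Equiv.Perm.sign_mul, Units.val_mul, Equiv.arrowCongr_apply, Equiv.symm_symm,
      Equiv.coe_refl, Function.comp_apply, id_eq, h3]
    linear_combination (((Equiv.Perm.sign w.1 : ℤˣ) : ℤ) * ∏ i, if w.2 i then (-1 : ℤ) else 1) * hs
  rw [h1, ← mul_assoc, ← Int.cast_mul, h2]

lemma alternate_comp_invLast (η : Fin 5 → K) (f : (Fin 5 → K) → K) :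
    alternate η (fun x => f (invLast x)) = -alternate η f := by
  rw [alternate, alternate, ← Finset.sum_neg_distrib]
  let φ : Equiv.Perm (Fin 5) × (Fin 5 → Bool) → Equiv.Perm (Fin 5) × (Fin 5 → Bool) :=
    fun w => (w.1, Function.update w.2 4 (!w.2 4))
  have hφ : Function.Involutive φ := fun w => by simp [φ]
  refine Fintype.sum_equiv hφ.toPerm _ _ fun w => ?_
  have h1 : signAct η (φ w) = invLast (signAct η w) := by
    ext i
    by_cases hi : i = 4
    · subst hi
      cases h : w.2 4 <;> simp [φ, signAct, invLast, signPow', h]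
    · simp [φ, signAct, invLast, signPow', hi]
  have h2 : weylSign (φ w) = -weylSign w := by
    simp only [weylSign, Fin.prod_univ_five]
    cases h : w.2 4 <;> simp [φ, h]
  change _ = -((weylSign (φ w) : K) * f (signAct η (φ w)))
  rw [h1, h2]
  push_cast
  ring

lemma alternate_laurent (η : Fin 5 → K) (e : Fin 5 → ℤ) :
    alternate η (laurent e) = alternant e η := by
  rw [alternate, alternant, Matrix.det_apply, Fintype.sum_prod_type]
  refine Finset.sum_congr rfl fun σ _ => ?_
  have h (i : Fin 5) : η (σ i) ^ e i - (η (σ i))⁻¹ ^ e i =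
      ∑ b ∈ (Finset.univ : Finset Bool), (if b then -1 else 1) * signPow' (η (σ i)) b ^ e i := by
    simp [signPow']; ring
  simp only [Matrix.of_apply, h, Finset.prod_univ_sum, Fintype.piFinset_univ, Finset.smul_sum]
  refine Finset.sum_congr rfl fun ε _ => ?_
  rw [weylSign, laurent, Finset.prod_mul_distrib, Units.smul_def, zsmul_eq_mul]
  push_cast
  simp only [signAct, mul_assoc]

lemma alternant_signAct (η : Fin 5 → K) (e : Fin 5 → ℤ) (w) :
    alternant e (signAct η w) = weylSign w * alternant e η := by
  let M : Matrix (Fin 5) (Fin 5) K := Matrix.of fun i j => η i ^ e j - (η i)⁻¹ ^ e j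
  have h : (Matrix.of fun i j => signAct η w i ^ e j - (signAct η w i)⁻¹ ^ e j) =
      Matrix.of fun i j => (if w.2 i then (-1 : K) else 1) * M.submatrix w.1 id i j := by
    ext i j
    cases h : w.2 i <;> simp [signAct, signPow', h, M]
  rw [alternant, h, Matrix.det_mul_column, Matrix.det_permute, weylSign]
  push_cast
  simp only [M, alternant]
  ring

lemma alternant_eq_zero (η : Fin 5 → K) {e : Fin 5 → ℤ}
    (h : (∃ j, e j = 0) ∨ ∃ i j, i ≠ j ∧ (e i = e j ∨ e i = -e j)) : alternant e η = 0 := by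
  obtain ⟨j, hj⟩ | ⟨i, j, hij, h | h⟩ := h
  · exact Matrix.det_eq_zero_of_column_eq_zero j fun i => by simp [hj]
  · exact Matrix.det_zero_of_column_eq hij fun k => by simp [h]
  · rw [alternant, ← Matrix.det_updateCol_add_smul_self _ hij 1]
    refine Matrix.det_eq_zero_of_column_eq_zero i fun k => ?_
    simp [h]

lemma alternant_rhoExponent {x : Fin 5 → K} (hx : ∀ i, x i ≠ 0) :
    alternant rhoExponent x = (∏ i, (x i - (x i)⁻¹)) *
      ∏ i, ∏ j ∈ Finset.Ioi i, (x j ^ 2 + (x j)⁻¹ ^ 2 - (x i ^ 2 + (x i)⁻¹ ^ 2)) := by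
  let T : Matrix (Fin 5) (Fin 5) ℤ :=
    !![-1, 1, 1, -1, 1; -1, -1, 2, 2, 0; 0, -1, -1, 3, 0; 0, 0, -1, -1, 0; 0, 0, 0, -1, 0]
  have hT : T.det = 1 := by decide +kernel
  have h : (Matrix.of fun i j => x i ^ rhoExponent j - (x i)⁻¹ ^ rhoExponent j) =
      Matrix.of fun i j => (x i - (x i)⁻¹) *
        (Matrix.vandermonde (fun i => x i ^ 2 + (x i)⁻¹ ^ 2) * T.map (Int.cast : ℤ → K)) i j := by
    ext i j
    simp only [Matrix.of_apply, Matrix.mul_apply, Fin.sum_univ_five, Matrix.vandermonde_apply,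
      Matrix.map_apply]
    have e (n : ℕ) : (x i) ^ (-(n : ℤ)) = (x i)⁻¹ ^ n := by simp
    have f (n : ℕ) : (x i)⁻¹ ^ (-(n : ℤ)) = x i ^ n := by simp
    have e3 := e 3
    have e5 := e 5
    have e7 := e 7
    have e9 := e 9
    have f3 := f 3
    have f5 := f 5
    have f7 := f 7
    have f9 := f 9
    push_cast at e3 e5 e7 e9 f3 f5 f7 f9
    have h0 := hx i
    fin_cases j <;> simp [rhoExponent, T, e3, e5, e7, e9, f3, f5, f7, f9, -inv_pow] <;>
    · field_simp
      ring
  rw [alternant, h, Matrix.det_mul_column, Matrix.det_mul, Matrix.det_vandermonde]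
  have : (T.map (Int.cast : ℤ → K)).det = 1 := by
    have := (Int.castRingHom K).map_det T
    rw [hT, map_one] at this
    exact this.symm
  rw [this, mul_one]

lemma partialAlternant_eq (x : Fin 5 → K) :
    partialAlternant x = (∏ i : Fin 4, (x i.castSucc)⁻¹ ^ 3) *
      (∏ i : Fin 4, ∏ j ∈ Finset.Ioi i, ((x j.castSucc)⁻¹ ^ 2 - (x i.castSucc)⁻¹ ^ 2)) *
        (x 4 - (x 4)⁻¹) := by
  rw [← Matrix.det_vandermonde (fun i : Fin 4 => (x i.castSucc)⁻¹ ^ 2), ← Matrix.det_mul_column,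
    Matrix.det_apply, partialAlternant, Finset.sum_mul]
  refine Finset.sum_congr rfl fun τ _ => ?_
  have hr (i : Fin 4) (y : K) : y ^ rhoExponent i.castSucc = y⁻¹ ^ 3 * (y⁻¹ ^ 2) ^ (i : ℕ) := by
    rw [← pow_mul, ← pow_add, ← zpow_natCast, inv_zpow']
    congr 1
    fin_cases i <;> rfl
  have hl (y : K) : y ^ rhoExponent 4 = y := by simp [rhoExponent]
  have hc (i : Fin 4) : invLast x i.castSucc = x i.castSucc := by
    rw [invLast, Function.update_of_ne]
    exact (Fin.castSucc_lt_last i).ne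
  have h4 : invLast x 4 = (x 4)⁻¹ := by simp [invLast]
  simp only [laurent, Fin.prod_univ_castSucc (n := 4), Function.comp_apply,
    extendPerm_castSucc, hc, hr, show Fin.last 4 = 4 from rfl, hl, extendPerm_last, h4,
    Matrix.of_apply, Matrix.vandermonde_apply, Units.smul_def, zsmul_eq_mul]
  ring

lemma numer_comp_extendPerm (t : K) (x : Fin 5 → K) (τ : Equiv.Perm (Fin 4)) :
    numer t (x ∘ extendPerm τ) = numer t x := by
  have h := Equiv.prod_comp (extendPerm τ) x
  have h' := Equiv.prod_comp (extendPerm τ) (fun i => 1 - t * (∏ i, x i) / x i ^ 2)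
  have hpair := Equiv.prod_comp τ
    (fun i => 1 - t * (∏ i, x i) / (x i.castSucc ^ 2 * x 4 ^ 2))
  simp only [numer, Function.comp_apply, h, h', extendPerm_castSucc, extendPerm_last, hpair]

lemma numer_invLast (t : K) {x : Fin 5 → K} (hx : ∀ i, x i ≠ 0) :
    numer t (invLast x) = numer t x := by
  have h0 := hx 0
  have h1 := hx 1
  have h2 := hx 2
  have h3 := hx 3
  have h4 := hx 4
  have hc (i : Fin 4) : invLast x i.castSucc = x i.castSucc := by
    rw [invLast, Function.update_of_ne]
    exact (Fin.castSucc_lt_last i).ne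
  have e (i : Fin 4) : t * (∏ i, invLast x i) / invLast x i.castSucc ^ 2 =
      t * (∏ i, x i) / (x i.castSucc ^ 2 * x 4 ^ 2) := by
    rw [hc]
    have := hx i.castSucc
    simp [Fin.prod_univ_five, invLast]
    field_simp
  have e' (i : Fin 4) : t * (∏ i, invLast x i) / (invLast x i.castSucc ^ 2 * invLast x 4 ^ 2) =
      t * (∏ i, x i) / (x i.castSucc ^ 2) := by
    rw [hc]
    have := hx i.castSucc
    simp [Fin.prod_univ_five, invLast]
    field_simp
  have e4 : t * (∏ i, invLast x i) / invLast x (Fin.last 4) ^ 2 = t * ∏ i, x i := by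
    simp [Fin.prod_univ_five, invLast, Fin.last]
    field_simp
  have e4' : t * ∏ i, invLast x i = t * (∏ i, x i) / x (Fin.last 4) ^ 2 := by
    simp [Fin.prod_univ_five, invLast, Fin.last]
    field_simp
  rw [numer, numer, Fin.prod_univ_castSucc (n := 4) (fun i => 1 - _ / invLast x i ^ 2),
    Fin.prod_univ_castSucc (n := 4) (fun i => 1 - _ / x i ^ 2)]
  simp only [e, e', e4]
  rw [e4']
  ring

lemma laurent_add {x : Fin 5 → K} (hx : ∀ i, x i ≠ 0) (e f : Fin 5 → ℤ) :
    laurent (e + f) x = laurent e x * laurent f x := by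
  simp only [laurent, Pi.add_apply, ← Finset.prod_mul_distrib]
  exact Finset.prod_congr rfl fun i _ => zpow_add₀ (hx i) _ _

lemma laurent_sum {x : Fin 5 → K} (hx : ∀ i, x i ≠ 0) (S : Finset (Fin 10)) :
    laurent (∑ k ∈ S, spinWeight k) x = ∏ k ∈ S, laurent (spinWeight k) x := by
  classical
  induction S using Finset.induction_on with
  | empty => simp [laurent]
  | insert k S hk ih => rw [Finset.sum_insert hk, Finset.prod_insert hk, laurent_add hx, ih]

lemma numer_eq (t : K) {x : Fin 5 → K} (hx : ∀ i, x i ≠ 0) :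
    numer t x = ∑ S : Finset (Fin 10), (-t) ^ S.card * laurent (∑ k ∈ S, spinWeight k) x := by
  have h : numer t x = ∏ k : Fin 10, (1 + -t * laurent (spinWeight k) x) := by
    have h0 := hx 0
    have h1 := hx 1
    have h2 := hx 2
    have h3 := hx 3
    have h4 := hx 4
    let v : Fin 10 → K := ![1, x 0 ^ 2, x 1 ^ 2, x 2 ^ 2, x 3 ^ 2, x 4 ^ 2,
      x 0 ^ 2 * x 4 ^ 2, x 1 ^ 2 * x 4 ^ 2, x 2 ^ 2 * x 4 ^ 2, x 3 ^ 2 * x 4 ^ 2]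
    have e (k : Fin 10) : 1 + -t * laurent (spinWeight k) x = 1 - t * (∏ i, x i) / v k := by
      fin_cases k <;> simp [laurent, spinWeight, Fin.prod_univ_five, v] <;> field_simp <;> ring
    simp only [e, numer]
    simp [Fin.prod_univ_succ, v]
    ring
  rw [h, Finset.prod_one_add, Finset.powerset_univ]
  refine Finset.sum_congr rfl fun S _ => ?_
  rw [Finset.prod_mul_distrib, Finset.prod_const, laurent_sum hx]

lemma exponent_degenerate : ∀ S : Finset (Fin 10), S ≠ ∅ →
    (∃ j, (rhoExponent + ∑ k ∈ S, spinWeight k) j = 0) ∨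
    ∃ i j, i ≠ j ∧
      ((rhoExponent + ∑ k ∈ S, spinWeight k) i = (rhoExponent + ∑ k ∈ S, spinWeight k) j ∨
        (rhoExponent + ∑ k ∈ S, spinWeight k) i =
          -(rhoExponent + ∑ k ∈ S, spinWeight k) j) := by
  decide +kernel

lemma signAct_ne_zero {η : Fin 5 → K} (h0 : ∀ i, η i ≠ 0) (w) (i) : signAct η w i ≠ 0 :=
  signPow'_ne_zero (h0 _) _

lemma alternate_congr {η : Fin 5 → K} (h0 : ∀ i, η i ≠ 0) {f g : (Fin 5 → K) → K}
    (h : ∀ x : Fin 5 → K, (∀ i, x i ≠ 0) → f x = g x) : alternate η f = alternate η g :=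
  Finset.sum_congr rfl fun w _ => by rw [h _ (signAct_ne_zero h0 w)]

lemma alternate_sum {ι : Type*} (s : Finset ι) (η : Fin 5 → K) (c : ι → K)
    (f : ι → (Fin 5 → K) → K) :
    alternate η (fun x => ∑ i ∈ s, c i * f i x) = ∑ i ∈ s, c i * alternate η (f i) := by
  simp only [alternate, Finset.mul_sum]
  rw [Finset.sum_comm]
  exact Finset.sum_congr rfl fun i _ => Finset.sum_congr rfl fun w _ => by ring

lemma alternate_sub (η : Fin 5 → K) (f g : (Fin 5 → K) → K) :
    alternate η (fun x => f x - g x) = alternate η f - alternate η g := by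
  simp only [alternate, mul_sub, Finset.sum_sub_distrib]

lemma alternate_numer_mul_laurent (t : K) {η : Fin 5 → K} (h0 : ∀ i, η i ≠ 0) :
    alternate η (fun x => numer t x * laurent rhoExponent x) = alternant rhoExponent η := by
  rw [alternate_congr h0 (g := fun x => ∑ S : Finset (Fin 10),
    (-t) ^ S.card * laurent (rhoExponent + ∑ k ∈ S, spinWeight k) x), alternate_sum,
    Finset.sum_eq_single ∅]
  · simp [alternate_laurent]
  · intro S _ hS
    rw [alternate_laurent, alternant_eq_zero η (exponent_degenerate S hS), mul_zero]
  · simp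
  · intro x hx
    rw [numer_eq t hx, Finset.sum_mul]
    refine Finset.sum_congr rfl fun S _ => ?_
    rw [laurent_add hx]
    ring

lemma alternate_numer_mul_partialAlternant (t : K) {η : Fin 5 → K} (h0 : ∀ i, η i ≠ 0) :
    alternate η (fun x => numer t x * partialAlternant x) = 48 * alternant rhoExponent η := by
  let g : (Fin 5 → K) → K := fun x => numer t x * laurent rhoExponent x
  have hinv (x : Fin 5 → K) (hx : ∀ i, x i ≠ 0) (i) : invLast x i ≠ 0 := by
    by_cases hi : i = 4
    · subst hi; simpa [invLast] using hx 4
    · simpa [invLast, hi] using hx i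
  rw [alternate_congr h0 (g := fun x => ∑ τ : Equiv.Perm (Fin 4),
    ((Equiv.Perm.sign τ : ℤ) : K) * (g (x ∘ extendPerm τ) - g (invLast x ∘ extendPerm τ))),
    alternate_sum]
  · have h (τ : Equiv.Perm (Fin 4)) : ((Equiv.Perm.sign τ : ℤ) : K) * alternate η (fun x =>
        g (x ∘ extendPerm τ) - g (invLast x ∘ extendPerm τ)) = 2 * alternant rhoExponent η := by
      have hs : ((Equiv.Perm.sign τ : ℤ) : K) * ((Equiv.Perm.sign τ : ℤ) : K) = 1 := by
        rw [← Int.cast_mul, ← Units.val_mul, Int.units_mul_self, Units.val_one, Int.cast_one]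
      rw [alternate_sub, alternate_comp_invLast η (fun x => g (x ∘ extendPerm τ)),
        alternate_comp_perm, sign_extendPerm, alternate_numer_mul_laurent t h0]
      linear_combination 2 * alternant rhoExponent η * hs
    rw [Finset.sum_congr rfl fun τ _ => h τ, Finset.sum_const, Finset.card_univ,
      Fintype.card_perm, Fintype.card_fin, nsmul_eq_mul, show Nat.factorial 4 = 24 from rfl]
    push_cast
    ring
  · intro x hx
    simp only [g, numer_comp_extendPerm, numer_invLast t hx, partialAlternant, Finset.mul_sum]
    exact Finset.sum_congr rfl fun τ _ => by ring

lemma alternant_eq_denom_mul {x : Fin 5 → K} (hx : ∀ i, x i ≠ 0) :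
    alternant rhoExponent x = denom x * partialAlternant x := by
  have h (a b : K) (ha : a ≠ 0) (hb : b ≠ 0) : b ^ 2 + b⁻¹ ^ 2 - (a ^ 2 + a⁻¹ ^ 2) =
      (1 - a ^ 2 * b ^ 2) * (b⁻¹ ^ 2 - a⁻¹ ^ 2) := by
    field_simp
    ring
  have h' (a b : K) (ha : a ≠ 0) (hb : b ≠ 0) :
      (a - a⁻¹) * (b ^ 2 + b⁻¹ ^ 2 - (a ^ 2 + a⁻¹ ^ 2)) =
        a⁻¹ ^ 3 * ((1 - a ^ 2 * b ^ 2) * (1 - a ^ 2) * (1 - a ^ 2 / b ^ 2)) := by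
    field_simp
    ring
  rw [alternant_rhoExponent hx, partialAlternant_eq, denom, Finset.prod_filter,
    Fintype.prod_prod_type]
  have hI (n : ℕ) (i : Fin n) : Finset.Ioi i = Finset.univ.filter (i < ·) := by
    ext j; simp
  simp only [hI, Finset.prod_filter, Fin.prod_univ_five, Fin.prod_univ_four]
  simp only [Fin.reduceLT, Fin.reduceCastSucc, if_true, if_false, lt_irrefl, one_mul, mul_one]
  rw [h (x 0) (x 1) (hx 0) (hx 1), h (x 0) (x 2) (hx 0) (hx 2), h (x 0) (x 3) (hx 0) (hx 3),
    h (x 1) (x 2) (hx 1) (hx 2), h (x 1) (x 3) (hx 1) (hx 3), h (x 2) (x 3) (hx 2) (hx 3)]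
  have hprod := congr_arg₂ (· * ·)
    (congr_arg₂ (· * ·) (h' (x 0) (x 4) (hx 0) (hx 4)) (h' (x 1) (x 4) (hx 1) (hx 4)))
    (congr_arg₂ (· * ·) (h' (x 2) (x 4) (hx 2) (hx 4)) (h' (x 3) (x 4) (hx 3) (hx 4)))
  have hmul := congr_arg (· * ((x 4 - (x 4)⁻¹) *
    ((1 - x 0 ^ 2 * x 1 ^ 2) * ((x 1)⁻¹ ^ 2 - (x 0)⁻¹ ^ 2)) *
    ((1 - x 0 ^ 2 * x 2 ^ 2) * ((x 2)⁻¹ ^ 2 - (x 0)⁻¹ ^ 2)) *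
    ((1 - x 0 ^ 2 * x 3 ^ 2) * ((x 3)⁻¹ ^ 2 - (x 0)⁻¹ ^ 2)) *
    ((1 - x 1 ^ 2 * x 2 ^ 2) * ((x 2)⁻¹ ^ 2 - (x 1)⁻¹ ^ 2)) *
    ((1 - x 1 ^ 2 * x 3 ^ 2) * ((x 3)⁻¹ ^ 2 - (x 1)⁻¹ ^ 2)) *
    ((1 - x 2 ^ 2 * x 3 ^ 2) * ((x 3)⁻¹ ^ 2 - (x 2)⁻¹ ^ 2)))) hprod
  convert hmul using 1 <;> ac_rfl

lemma alternant_ne_zero {η : Fin 5 → K} (h0 : ∀ i, η i ≠ 0) (h1 : ∀ i, (η i) ^ 2 ≠ 1)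
    (hd : ∀ i j, i ≠ j → (η i) ^ 2 ≠ (η j) ^ 2)
    (hp : ∀ i j, i ≠ j → (η i) ^ 2 * (η j) ^ 2 ≠ 1) : alternant rhoExponent η ≠ 0 := by
  rw [alternant_rhoExponent h0]
  refine mul_ne_zero (Finset.prod_ne_zero_iff.2 fun i _ h => h1 i ?_)
    (Finset.prod_ne_zero_iff.2 fun i _ => Finset.prod_ne_zero_iff.2 fun j hj h => ?_)
  · have := h0 i
    field_simp at h
    linear_combination h
  · have hij : i ≠ j := (Finset.mem_Ioi.1 hj).ne
    have hi := h0 i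
    have hj := h0 j
    have : (η i ^ 2 - η j ^ 2) * (η i ^ 2 * η j ^ 2 - 1) = 0 := by
      field_simp at h
      linear_combination -h
    rcases mul_eq_zero.1 this with h | h
    · exact hd i j hij (sub_eq_zero.1 h)
    · exact hp i j hij (sub_eq_zero.1 h)

end

/-- The Whittaker–Shintani reduction identity for `(GSp₁₀, GL₂⋉U)`.  We adjoin square
roots by working with variables `ηᵢ` and `θᵢ = ηᵢ²`, `ξ = η₁⋯η₅`, over an arbitrary
field, with nonvanishing hypotheses making all denominators nonzero.  The Weyl group
`W(C₅)` of signed permutations is parametrized by pairs `(σ, ε)`, with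
`w·θᵢ = θ_{σ(i)}^{±1}` and `w·ξ` the corresponding product of the `η_{σ(i)}^{±1}`.
The summand is invariant under the subgroup `S₄×S₂` (of order 48), so the statement
"the sum over the cosets `W/(S₄×S₂)` equals 1" is expressed as: the sum over all of
`W(C₅)` of
`(1 − q^{-1/2}ξ)·∏_{i=1}^{5}(1 − q^{-1/2}ξ/θᵢ)·∏_{i=1}^{4}(1 − q^{-1/2}ξ/(θᵢθ₅))
  / (∏_{i<j}(1 − θᵢθⱼ)·∏_{i=1}^{4}(1 − θᵢ)·∏_{i=1}^{4}(1 − θᵢ/θ₅))`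
(with `w` applied) equals `48`. -/
theorem stmt_18 {K : Type*} [Field K] (t : K) (η : Fin 5 → K)
    (h0 : ∀ i, η i ≠ 0)
    (h1 : ∀ i, (η i) ^ 2 ≠ 1)
    (hd : ∀ i j, i ≠ j → (η i) ^ 2 ≠ (η j) ^ 2)
    (hp : ∀ i j, i ≠ j → (η i) ^ 2 * (η j) ^ 2 ≠ 1) :
    ∑ w : Equiv.Perm (Fin 5) × (Fin 5 → Bool),
      (let tη : Fin 5 → K := fun i => signPow' (η (w.1 i)) (w.2 i)
       let tθ : Fin 5 → K := fun i => (tη i) ^ 2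
       let ξ : K := ∏ i, tη i
       ((1 - t * ξ) * (∏ i, (1 - t * ξ / tθ i)) *
          (∏ i : Fin 4, (1 - t * ξ / (tθ i.castSucc * tθ 4)))) /
        ((∏ p ∈ Finset.univ.filter (fun p : Fin 5 × Fin 5 => p.1 < p.2),
            (1 - tθ p.1 * tθ p.2)) *
          (∏ i : Fin 4, (1 - tθ i.castSucc)) *
          (∏ i : Fin 4, (1 - tθ i.castSucc / tθ 4))))
    = 48 := by
  have hD := alternant_ne_zero h0 h1 hd hp
  have key := alternate_numer_mul_partialAlternant t h0
  rw [← div_eq_iff hD, alternate, Finset.sum_div] at key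
  rw [← key]
  refine Finset.sum_congr rfl fun w _ => ?_
  change numer t (signAct η w) / denom (signAct η w) = _
  have hs : (weylSign w : K) * weylSign w = 1 := by
    rw [← Int.cast_mul, weylSign_mul_self, Int.cast_one]
  have hw := alternant_signAct η rhoExponent w
  have hfac := alternant_eq_denom_mul (signAct_ne_zero h0 w)
  have hne : denom (signAct η w) * partialAlternant (signAct η w) ≠ 0 := by
    rw [← hfac, hw]
    exact mul_ne_zero (left_ne_zero_of_mul_eq_one hs) hD
  rw [div_eq_div_iff (left_ne_zero_of_mul hne) hD]
  linear_combination numer t (signAct η w) * (weylSign w * (hfac - hw) -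
    alternant rhoExponent η * hs)
end

section
/- Let q^{1/2} and θ₁,…,θ₆ be indeterminates, and write ξ = (θ₁θ₂θ₃θ₄θ₅θ₆)^{1/2}. Then, as an identity of rational functions: Σ over the Weyl group W of type D₆ (signed permutations of θ₁,…,θ₆ with an even number of sign changes, i.e., evenly many inversions θ_i ↦ θ_i^{-1}), modulo the subgroup S₆ of ordinary permutations, of w( ∏_{i=1}^{6} (1 − q^{-1/2} ξ/θ_i) / ∏_{1≤i<j≤6} (1 − θ_iθ_j) ) = 1. -/
/-- `x ^ ε` for a sign `ε ∈ {±1}` encoded by a `Bool` (`false ↔ +1`, `true ↔ −1`). -/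
def signPowD {K : Type*} [Field K] (x : K) (b : Bool) : K := if b then x⁻¹ else x

section CosetSum

open Matrix Finset

/-- The product `∏ (1 - s zᵢ)` times the Vandermonde determinant of `z`, expanded in powers of `s`
as a sum of generalized Vandermonde determinants omitting one exponent. -/
theorem prod_one_sub_mul_det_vandermonde {R : Type*} [CommRing R] (s : R) (z : Fin 6 → R) :
    (∏ i, (1 - s * z i)) * (vandermonde z).det =
      ∑ j : Fin 7, (-1) ^ (j : ℕ) * s ^ (j.rev : ℕ) *
        (of fun i c : Fin 6 => z i ^ (j.succAbove c : ℕ)).det := by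
  have h := det_projVandermonde (Fin.cons 1 z : Fin 7 → R) (Fin.cons s fun _ => 1)
  rw [det_succ_row_zero] at h
  have hl : (∏ i, (1 - s * z i)) = ∏ i, (z i * s - 1) := by
    simp only [Fin.prod_univ_succ, Fin.prod_univ_zero]
    ring
  rw [Fin.prod_univ_succ, Fin.prod_Ioi_zero] at h
  simp only [Fin.prod_Ioi_succ, Fin.cons_zero, Fin.cons_succ, mul_one] at h
  rw [hl, det_vandermonde, ← h]
  refine sum_congr rfl fun j _ => ?_
  congr 1
  · simp [projVandermonde_apply]
  · congr 1
    ext i c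
    simp [projVandermonde_apply]

/-- Summing a determinant over independent choices of a row in each position. -/
theorem sum_prod_mul_det_rows {R : Type*} [CommRing R] {n : ℕ} {β : Type*} [Fintype β]
    (c : β → R) (r : Fin n → β → Fin n → R) :
    ∑ ε : Fin n → β, (∏ i, c (ε i)) * (of fun i => r i (ε i)).det =
      (of fun i k => ∑ b, c b * r i b k).det := by
  have h := (detRowAlternating (R := R) (n := Fin n)).toMultilinearMap.map_sum
    (fun i b => c b • r i b)
  simp only [MultilinearMap.map_smul_univ, smul_eq_mul] at h
  refine h.symm.trans ?_
  change det _ = det _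
  congr 1
  ext i k
  simp

theorem det_eq_zero_of_col_eq_mul {R : Type*} [CommRing R] {n : ℕ} (M : Matrix (Fin n) (Fin n) R)
    (κ : R) {i j : Fin n} (hij : i ≠ j) (h : ∀ k, M k j = κ * M k i) : M.det = 0 := by
  have hM : M = M.updateCol j (κ • fun k => M k i) := by
    ext a b
    by_cases hb : b = j
    · subst hb; simp [h]
    · simp [hb]
  rw [hM, det_updateCol_smul, det_zero_of_column_eq hij, mul_zero]
  intro k
  simp [hij]

open Polynomial in
/-- The denominator formula for `D₆`, up to the factor `2` carried by the constant column. -/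
theorem det_pow_add_inv_pow {K : Type*} [Field K] (x : Fin 6 → K) (hx : ∀ i, x i ≠ 0) :
    (of fun i k : Fin 6 => x i ^ (k : ℕ) + (x i)⁻¹ ^ (k : ℕ)).det =
      2 * (vandermonde fun i => x i + (x i)⁻¹).det := by
  let p : Fin 6 → K[X] := ![1, X, X ^ 2 - C 2, X ^ 3 - C 3 * X, X ^ 4 - C 4 * X ^ 2 + C 2,
    X ^ 5 - C 5 * X ^ 3 + C 5 * X]
  have hdeg : ∀ i, (p i).natDegree = i := by
    intro i
    fin_cases i <;> simp only [p] <;> simp <;> compute_degree!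
  have hmonic : ∀ i, (p i).Monic := by
    intro i
    fin_cases i <;> simp only [p] <;> simp <;> monicity!
  rw [det_eval_matrixOfPolynomials_eq_det_vandermonde _ p hdeg hmonic]
  have h2 : (2 : K) = ∏ i : Fin 6, (![2, 1, 1, 1, 1, 1] : Fin 6 → K) i := by
    simp [Fin.prod_univ_succ]
  rw [h2, ← det_mul_row]
  congr 1
  ext i k
  have := hx i
  fin_cases k <;> simp [p] <;> first | norm_num; done | (field_simp; ring)

theorem signPowD_ne_zero {K : Type*} [Field K] {x : K} (hx : x ≠ 0) (b : Bool) :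
    signPowD x b ≠ 0 := by
  cases b <;> simpa [signPowD] using hx

/-- For `κ = ±1`, the sum over all sign choices weighted by the product of the `κ`'s. -/
theorem sum_prod_mul_prod_mul_det {K : Type*} [Field K] (t κ : K) (hκ : κ * κ = 1)
    (η : Fin 6 → K) (h0 : ∀ i, η i ≠ 0) :
    ∑ ε : Fin 6 → Bool, (∏ i, if ε i then κ else 1) *
      ((∏ i, (1 - t * (∏ k, signPowD (η k) (ε k)) * ((signPowD (η i) (ε i)) ^ 2)⁻¹)) *
        (vandermonde fun i => ((signPowD (η i) (ε i)) ^ 2)⁻¹).det) =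
      (of fun i k : Fin 6 => (η i ^ 2)⁻¹ ^ (k : ℕ) + κ * (η i ^ 2) ^ (k : ℕ)).det := by
  have hrow (j : Fin 7) (ε : Fin 6 → Bool) :
      (∏ k, signPowD (η k) (ε k)) ^ (j.rev : ℕ) *
        (of fun i c : Fin 6 => ((signPowD (η i) (ε i)) ^ 2)⁻¹ ^ (j.succAbove c : ℕ)).det =
      (of fun i => (fun (i : Fin 6) (b : Bool) (c : Fin 6) => signPowD (η i) b ^ (j.rev : ℕ) *
        ((signPowD (η i) b) ^ 2)⁻¹ ^ (j.succAbove c : ℕ)) i (ε i)).det := by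
    rw [← prod_pow, ← det_mul_column]
    rfl
  have hexp (ε : Fin 6 → Bool) := prod_one_sub_mul_det_vandermonde
    (t * (∏ k, signPowD (η k) (ε k))) (fun i => ((signPowD (η i) (ε i)) ^ 2)⁻¹)
  simp only [hexp, mul_sum]
  rw [sum_comm]
  have hterm (j : Fin 7) : ∑ ε : Fin 6 → Bool, (∏ i, if ε i then κ else 1) *
      ((-1) ^ (j : ℕ) * (t * (∏ k, signPowD (η k) (ε k))) ^ (j.rev : ℕ) *
        (of fun i c : Fin 6 => ((signPowD (η i) (ε i)) ^ 2)⁻¹ ^ (j.succAbove c : ℕ)).det) =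
      (-1) ^ (j : ℕ) * t ^ (j.rev : ℕ) * (of fun i c : Fin 6 => η i ^ (j.rev : ℕ) *
        (η i ^ 2)⁻¹ ^ (j.succAbove c : ℕ) + κ * ((η i)⁻¹ ^ (j.rev : ℕ) *
        ((η i)⁻¹ ^ 2)⁻¹ ^ (j.succAbove c : ℕ))).det := by
    have h := sum_prod_mul_det_rows (fun b : Bool => if b then κ else 1)
      (fun (i : Fin 6) (b : Bool) (c : Fin 6) => signPowD (η i) b ^ (j.rev : ℕ) *
        ((signPowD (η i) b) ^ 2)⁻¹ ^ (j.succAbove c : ℕ))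
    have hentry (i c : Fin 6) : ∑ b : Bool, (if b then κ else 1) * (signPowD (η i) b ^ (j.rev : ℕ) *
        ((signPowD (η i) b) ^ 2)⁻¹ ^ (j.succAbove c : ℕ)) = η i ^ (j.rev : ℕ) *
        (η i ^ 2)⁻¹ ^ (j.succAbove c : ℕ) + κ * ((η i)⁻¹ ^ (j.rev : ℕ) *
        ((η i)⁻¹ ^ 2)⁻¹ ^ (j.succAbove c : ℕ)) := by
      simp [signPowD, add_comm]
    simp only [← hrow, hentry] at h
    rw [← h, mul_sum]
    refine sum_congr rfl fun ε _ => ?_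
    rw [mul_pow]
    ring
  rw [sum_congr rfl fun j _ => hterm j, sum_eq_single (Fin.last 6)]
  · simp only [Fin.val_last, Fin.rev_last, Fin.succAbove_last, Fin.val_castSucc, Fin.val_zero,
      pow_zero, one_mul, mul_one, inv_pow, inv_inv, Even.neg_one_pow (by decide : Even 6)]
  · intro j _ hj
    have hcols : ∃ a b : Fin 6, a ≠ b ∧
        (j.succAbove a : ℕ) + (j.succAbove b : ℕ) = (j.rev : ℕ) := by
      revert hj
      revert j
      decide
    obtain ⟨a, b, hab, hk⟩ := hcols
    rw [det_eq_zero_of_col_eq_mul _ κ hab, mul_zero]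
    intro i
    have hi := h0 i
    simp only [of_apply, ← hk, pow_add, mul_add]
    rw [← mul_assoc κ κ, hκ, one_mul, add_comm]
    simp only [inv_pow, inv_inv, ← pow_mul]
    congr 1 <;> · field_simp; ring
  · simp

/-- The `D₆` denominators in terms of Vandermonde determinants. -/
theorem det_vandermonde_inv_mul_prod {K : Type*} [Field K] (x : Fin 6 → K)
    (hx : ∀ i, x i ≠ 0) :
    (vandermonde fun i => (x i)⁻¹).det *
        ∏ p ∈ univ.filter (fun p : Fin 6 × Fin 6 => p.1 < p.2), (1 - x p.1 * x p.2) =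
      (vandermonde fun i => x i + (x i)⁻¹).det := by
  have hden : ∏ p ∈ univ.filter (fun p : Fin 6 × Fin 6 => p.1 < p.2), (1 - x p.1 * x p.2) =
      ∏ i, ∏ j ∈ Ioi i, (1 - x i * x j) := by
    rw [prod_filter, ← univ_product_univ, prod_product]
    refine prod_congr rfl fun i _ => ?_
    rw [← prod_filter]
    congr 1
    ext j
    simp
  rw [hden, det_vandermonde, det_vandermonde, ← prod_mul_distrib]
  refine prod_congr rfl fun i _ => ?_
  rw [← prod_mul_distrib]
  refine prod_congr rfl fun j _ => ?_
  have hi := hx i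
  have hj := hx j
  field_simp
  ring

theorem add_inv_signPowD_sq {K : Type*} [Field K] (x : K) (b : Bool) :
    signPowD x b ^ 2 + (signPowD x b ^ 2)⁻¹ = x ^ 2 + (x ^ 2)⁻¹ := by
  cases b <;> simp [signPowD, add_comm]

theorem two_mul_sum_even {K : Type*} [Field K] (f : (Fin 6 → Bool) → K) :
    2 * ∑ ε ∈ univ.filter (fun ε : Fin 6 → Bool => Even (univ.filter (fun i => ε i = true)).card),
      f ε = ∑ ε : Fin 6 → Bool, (∏ i, if ε i then (1 : K) else 1) * f ε +
        ∑ ε : Fin 6 → Bool, (∏ i, if ε i then (-1 : K) else 1) * f ε := by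
  rw [← sum_add_distrib, mul_sum, sum_filter]
  refine sum_congr rfl fun ε _ => ?_
  have hprod : (∏ i, if ε i then (-1 : K) else 1) =
      (-1) ^ (univ.filter (fun i => ε i = true)).card := by
    rw [prod_ite, prod_const, prod_const_one, mul_one]
  rw [hprod]
  split_ifs with h
  · simp [h.neg_one_pow, two_mul]
  · simp [(Nat.not_even_iff_odd.mp h).neg_one_pow]

/-- Twice the sum over the even sign changes, after multiplying by the common denominator. -/
theorem two_mul_sum_even_prod_mul_det {K : Type*} [Field K] (t : K)
    (η : Fin 6 → K) (h0 : ∀ i, η i ≠ 0) :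
    2 * ∑ ε ∈ univ.filter (fun ε : Fin 6 → Bool => Even (univ.filter (fun i => ε i = true)).card),
      ((∏ i, (1 - t * (∏ k, signPowD (η k) (ε k)) * ((signPowD (η i) (ε i)) ^ 2)⁻¹)) *
        (vandermonde fun i => ((signPowD (η i) (ε i)) ^ 2)⁻¹).det) =
      2 * (vandermonde fun i => η i ^ 2 + (η i ^ 2)⁻¹).det := by
  rw [two_mul_sum_even, sum_prod_mul_prod_mul_det t 1 (by ring) η h0,
    sum_prod_mul_prod_mul_det t (-1) (by ring) η h0,
    ← det_pow_add_inv_pow (fun i => η i ^ 2) (fun i => pow_ne_zero 2 (h0 i)),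
    det_eq_zero_of_column_eq_zero (A := of fun i k : Fin 6 =>
      (η i ^ 2)⁻¹ ^ (k : ℕ) + -1 * (η i ^ 2) ^ (k : ℕ)) 0 (by simp), add_zero]
  simp [add_comm]

/-- The summand attached to the signed variables `x`. -/
def cosetTerm {K : Type*} [Field K] (t : K) (x : Fin 6 → K) : K :=
  (∏ i, (1 - t * (∏ k, x k) / x i ^ 2)) /
    (∏ p ∈ univ.filter (fun p : Fin 6 × Fin 6 => p.1 < p.2), (1 - x p.1 ^ 2 * x p.2 ^ 2))

theorem cosetTerm_eq {K : Type*} [Field K] (t : K) (x : Fin 6 → K) (hx : ∀ i, x i ≠ 0)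
    (hV : (vandermonde fun i => x i ^ 2 + (x i ^ 2)⁻¹).det ≠ 0) :
    cosetTerm t x = (∏ i, (1 - t * (∏ k, x k) * (x i ^ 2)⁻¹)) *
      (vandermonde fun i => (x i ^ 2)⁻¹).det /
        (vandermonde fun i => x i ^ 2 + (x i ^ 2)⁻¹).det := by
  have h := det_vandermonde_inv_mul_prod (fun i => x i ^ 2) fun i => pow_ne_zero 2 (hx i)
  have hz := left_ne_zero_of_mul (h.trans_ne hV)
  rw [← h, cosetTerm, mul_comm (vandermonde _).det, mul_div_mul_right _ _ hz]
  simp only [div_eq_mul_inv]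

theorem cosetTerm_comp_perm {K : Type*} [Field K] (t : K) (x : Fin 6 → K) (hx : ∀ i, x i ≠ 0)
    (hV : (vandermonde fun i => x i ^ 2 + (x i ^ 2)⁻¹).det ≠ 0) (σ : Equiv.Perm (Fin 6)) :
    cosetTerm t (x ∘ σ) = cosetTerm t x := by
  have hperm (v : Fin 6 → K) : (vandermonde fun i => v (σ i)).det =
      (Equiv.Perm.sign σ : K) * (vandermonde v).det := det_permute σ (vandermonde v)
  have hs : ((Equiv.Perm.sign σ : ℤ) : K) ≠ 0 := by
    rcases Int.units_eq_one_or (Equiv.Perm.sign σ) with h | h <;> simp [h]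
  have hu := hperm fun i => x i ^ 2 + (x i ^ 2)⁻¹
  have hz := hperm fun i => (x i ^ 2)⁻¹
  have hprod : ∏ k, x (σ k) = ∏ k, x k := Equiv.prod_comp σ x
  rw [cosetTerm_eq t x hx hV, cosetTerm_eq t (x ∘ σ) (fun i => hx (σ i))
    (hu.trans_ne (mul_ne_zero hs hV))]
  simp only [Function.comp_apply]
  rw [hu, hz, hprod, Equiv.prod_comp σ fun i => 1 - t * (∏ k, x k) * (x i ^ 2)⁻¹,
    mul_left_comm, mul_div_mul_left _ _ hs]

theorem two_mul_sum_cosetTerm {K : Type*} [Field K] (t : K) (η : Fin 6 → K)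
    (h0 : ∀ i, η i ≠ 0) (hV : (vandermonde fun i => η i ^ 2 + (η i ^ 2)⁻¹).det ≠ 0) :
    2 * ∑ ε ∈ univ.filter (fun ε : Fin 6 → Bool => Even (univ.filter (fun i => ε i = true)).card),
      cosetTerm t (fun i => signPowD (η i) (ε i)) = 2 := by
  have hterm (ε : Fin 6 → Bool) := cosetTerm_eq t (fun i => signPowD (η i) (ε i))
    (fun i => signPowD_ne_zero (h0 i) (ε i))
  simp only [add_inv_signPowD_sq] at hterm
  simp only [fun ε => hterm ε hV]
  rw [← sum_div, mul_div_assoc', two_mul_sum_even_prod_mul_det t η h0, mul_div_cancel_right₀ _ hV]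

theorem det_vandermonde_add_inv_ne_zero {K : Type*} [Field K] (x : Fin 6 → K)
    (hx : ∀ i, x i ≠ 0) (hd : ∀ i j, i ≠ j → x i ≠ x j) (hp : ∀ i j, i ≠ j → x i * x j ≠ 1) :
    (vandermonde fun i => x i + (x i)⁻¹).det ≠ 0 := by
  rw [det_vandermonde_ne_zero_iff]
  intro i j hij
  by_contra hne
  have hi := hx i
  have hj := hx j
  have h : (x i - x j) * (x i * x j - 1) = 0 := by
    field_simp at hij
    linear_combination hij
  rcases mul_eq_zero.mp h with h | h
  · exact hd i j hne (sub_eq_zero.mp h)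
  · exact hp i j hne (sub_eq_zero.mp h)

end CosetSum

/-- The Whittaker–Shintani coset-sum identity for `(GSO₁₂, GL₂⋉U)`.  We adjoin square
roots by working with variables `ηᵢ` and `θᵢ = ηᵢ²`, `ξ = η₁⋯η₆`, over an arbitrary
field with nonvanishing hypotheses making all denominators nonzero.  The Weyl group
`W(D₆)` consists of the signed permutations `(σ, ε)` with an even number of sign
changes, acting by `w·θᵢ = θ_{σ(i)}^{±1}` (and correspondingly on `ξ`).  The summand
is invariant under the subgroup `S₆` (of order 720), so the statement "the sum over
the cosets `W(D₆)/S₆` equals 1" is expressed as: the sum over all of `W(D₆)` of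
`∏_{i=1}^{6}(1 − q^{-1/2}ξ/θᵢ) / ∏_{1≤i<j≤6}(1 − θᵢθⱼ)` (with `w` applied)
equals `720`. -/
theorem stmt_19 {K : Type*} [Field K] (t : K) (η : Fin 6 → K)
    (h0 : ∀ i, η i ≠ 0)
    (hd : ∀ i j, i ≠ j → (η i) ^ 2 ≠ (η j) ^ 2)
    (hp : ∀ i j, i ≠ j → (η i) ^ 2 * (η j) ^ 2 ≠ 1) :
    ∑ w ∈ Finset.univ.filter
        (fun w : Equiv.Perm (Fin 6) × (Fin 6 → Bool) =>
          Even (Finset.univ.filter (fun i => w.2 i = true)).card),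
      (let tη : Fin 6 → K := fun i => signPowD (η (w.1 i)) (w.2 i)
       let tθ : Fin 6 → K := fun i => (tη i) ^ 2
       let ξ : K := ∏ i, tη i
       (∏ i, (1 - t * ξ / tθ i)) /
        (∏ p ∈ Finset.univ.filter (fun p : Fin 6 × Fin 6 => p.1 < p.2),
            (1 - tθ p.1 * tθ p.2)))
    = 720 := by
  have hV := det_vandermonde_add_inv_ne_zero (fun i => η i ^ 2)
    (fun i => pow_ne_zero 2 (h0 i)) hd hp
  have hsum : ∀ σ : Equiv.Perm (Fin 6),
      ∑ ε ∈ Finset.univ.filter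
        (fun ε : Fin 6 → Bool => Even (Finset.univ.filter (fun i => ε i = true)).card),
        cosetTerm t (fun i => signPowD (η (σ i)) (ε i)) =
      ∑ ε ∈ Finset.univ.filter
        (fun ε : Fin 6 → Bool => Even (Finset.univ.filter (fun i => ε i = true)).card),
        cosetTerm t (fun i => signPowD (η i) (ε i)) := by
    intro σ
    refine (Finset.sum_equiv (σ.arrowCongr (Equiv.refl Bool)).symm (fun ε => ?_)
      fun ε _ => ?_).symm
    · have hcard : (Finset.univ.filter (fun i => ε (σ i) = true)).card =
          (Finset.univ.filter (fun i => ε i = true)).card :=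
        Finset.card_equiv σ (by simp)
      simp [Equiv.arrowCongr, hcard]
    · refine (cosetTerm_comp_perm t (fun i => signPowD (η i) (ε i))
        (fun i => signPowD_ne_zero (h0 i) (ε i)) ?_ σ).symm
      simpa only [add_inv_signPowD_sq] using hV
  have hprod : Finset.univ.filter (fun w : Equiv.Perm (Fin 6) × (Fin 6 → Bool) =>
      Even (Finset.univ.filter (fun i => w.2 i = true)).card) =
      Finset.univ ×ˢ Finset.univ.filter
        (fun ε : Fin 6 → Bool => Even (Finset.univ.filter (fun i => ε i = true)).card) := by
    ext w
    simp
  refine (Finset.sum_congr hprod fun w _ =>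
    (rfl : _ = cosetTerm t fun i => signPowD (η (w.1 i)) (w.2 i))).trans ?_
  rw [Finset.sum_product, Finset.sum_congr rfl fun σ _ => hsum σ, Finset.sum_const,
    Finset.card_univ, Fintype.card_perm, Fintype.card_fin, nsmul_eq_mul]
  have h2 := two_mul_sum_cosetTerm t η h0 hV
  norm_num [Nat.factorial]
  linear_combination 360 * h2
end
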